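/- The propositionally quantified modal language with global modality L∃U is computably closed for relativisation: there is a computable function which, given formulas φ and A of L∃U, produces a formula ψ of L∃U such that for every relational model M, the extension of ψ in M equals the extension of φ in the relativised model M|⟦A⟧^M. -/

import Mathlib

/-- A relational model over a set of worlds `W`. -/
structure Model (W : Type) where
  rel : W → W → Prop
  val : ℕ → Set W

/-- Change the valuation of the proposition letter `p` to `X`. -/
def Model.update {W : Type} (M : Model W) (p : ℕ) (X : Set W) : Model W :=
  ⟨M.rel, fun q => if q = p then X else M.val q⟩

/-- Restriction (relativisation) of a model to a subset of its domain. -/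
def Model.restrict {W : Type} (M : Model W) (A : Set W) : Model A :=
  ⟨fun a b => M.rel a.1 b.1, fun p => {a | a.1 ∈ M.val p}⟩

/-- The language `L∃U`: propositionally quantified modal logic with the global modality. -/
inductive Form : Type where
  | atom : ℕ → Form
  | neg : Form → Form
  | and : Form → Form → Form
  | box : Form → Form
  | ex : ℕ → Form → Form
  | uni : Form → Form

/-- Satisfaction for `L∃U`. -/
def Sat {W : Type} : Model W → W → Form → Prop
  | M, w, .atom p => w ∈ M.val p
  | M, w, .neg φ => ¬ Sat M w φ
  | M, w, .and φ ψ => Sat M w φ ∧ Sat M w ψ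
  | M, w, .box φ => ∀ v, M.rel w v → Sat M v φ
  | M, w, .ex p φ => ∃ X : Set W, Sat (M.update p X) w φ
  | M, w, .uni φ => ∀ v, Sat M v φ

/-- Material implication, `φ ⊃ ψ`. -/
def Form.imp (φ ψ : Form) : Form := .neg (.and φ (.neg ψ))

/-- The proposition letter `p` occurs in a formula. -/
def Form.Occurs (p : ℕ) : Form → Prop
  | .atom q => q = p
  | .neg φ => φ.Occurs p
  | .and φ ψ => φ.Occurs p ∨ ψ.Occurs p
  | .box φ => φ.Occurs p
  | .ex q φ => q = p ∨ φ.Occurs p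
  | .uni φ => φ.Occurs p

/-- The formula contains no global modality `U` (i.e. is in `L∃`). -/
def Form.UFree : Form → Prop
  | .atom _ => True
  | .neg φ => φ.UFree
  | .and φ ψ => φ.UFree ∧ ψ.UFree
  | .box φ => φ.UFree
  | .ex _ φ => φ.UFree
  | .uni _ => False

/-- Semantics of the dynamic relativisation (public announcement) modality `⟨!A⟩φ`. -/
def SatRel {W : Type} (M : Model W) (w : W) (A φ : Form) : Prop :=
  ∃ h : w ∈ {v | Sat M v A}, Sat (M.restrict {v | Sat M v A}) ⟨w, h⟩ φ

/-- An event model with `n` events `α_0, …, α_{n-1}`, preconditions in `L∃U`. -/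
structure EventModel (n : ℕ) where
  E : Fin n → Fin n → Prop
  pre : Fin n → Form

/-- The domain of the product update `M ⊗ A`. -/
def prodDomain {W : Type} (M : Model W) {n : ℕ} (A : EventModel n) : Set (W × Fin n) :=
  {x | Sat M x.1 (A.pre x.2)}

/-- The product update `M ⊗ A`. -/
def prodModel {W : Type} (M : Model W) {n : ℕ} (A : EventModel n) :
    Model (prodDomain M A) :=
  ⟨fun x y => M.rel x.1.1 y.1.1 ∧ A.E x.1.2 y.1.2, fun p => {x | x.1.1 ∈ M.val p}⟩

/-- Semantics of the action modality `⟨α⟩φ` for `φ ∈ L∃U`. -/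
def SatAct {W : Type} {n : ℕ} (M : Model W) (A : EventModel n) (α : Fin n) (w : W)
    (φ : Form) : Prop :=
  ∃ h : (w, α) ∈ prodDomain M A, Sat (prodModel M A) ⟨(w, α), h⟩ φ

/-- The set of sentences `S∃Uj`: `L∃U` plus action nominals `j_i`. -/
inductive FormJ (n : ℕ) : Type where
  | atom : ℕ → FormJ n
  | nom : Fin n → FormJ n
  | neg : FormJ n → FormJ n
  | and : FormJ n → FormJ n → FormJ n
  | box : FormJ n → FormJ n
  | ex : ℕ → FormJ n → FormJ n
  | uni : FormJ n → FormJ n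

/-- Satisfaction for `S∃Uj`, relative to a labelling of worlds by events
(in a product model `M ⊗ A` the label of `(ω, α)` is `α`). -/
def SatJ {n : ℕ} {V : Type} (lab : V → Fin n) : Model V → V → FormJ n → Prop
  | M, w, .atom p => w ∈ M.val p
  | _, w, .nom i => lab w = i
  | M, w, .neg φ => ¬ SatJ lab M w φ
  | M, w, .and φ ψ => SatJ lab M w φ ∧ SatJ lab M w ψ
  | M, w, .box φ => ∀ v, M.rel w v → SatJ lab M v φ
  | M, w, .ex p φ => ∃ X : Set V, SatJ lab (M.update p X) w φ
  | M, w, .uni φ => ∀ v, SatJ lab M v φ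

/-- Semantics of the action modality `⟨α⟩ψ` applied to a sentence `ψ ∈ S∃Uj`:
`M, w ⊨ ⟨α⟩ψ` iff `M, w ⊨ Pre_α` and `M ⊗ A, (w, α) ⊨ ψ`. -/
def SatActJ {W : Type} {n : ℕ} (M : Model W) (A : EventModel n) (α : Fin n) (w : W)
    (ψ : FormJ n) : Prop :=
  ∃ h : (w, α) ∈ prodDomain M A,
    SatJ (fun x : prodDomain M A => x.1.2) (prodModel M A) ⟨(w, α), h⟩ ψ

/-- The proposition letter `p` occurs in a sentence of `S∃Uj`. -/
def FormJ.Occurs {n : ℕ} (p : ℕ) : FormJ n → Prop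
  | .atom q => q = p
  | .nom _ => False
  | .neg φ => φ.Occurs p
  | .and φ ψ => φ.Occurs p ∨ ψ.Occurs p
  | .box φ => φ.Occurs p
  | .ex q φ => q = p ∨ φ.Occurs p
  | .uni φ => φ.Occurs p

/-- Substitution `φ(σ)` of the sentence `σ` for the proposition letter `p` in `φ`. -/
def FormJ.subst {n : ℕ} (p : ℕ) (σ : FormJ n) : FormJ n → FormJ n
  | .atom q => if q = p then σ else .atom q
  | .nom i => .nom i
  | .neg φ => .neg (FormJ.subst p σ φ)
  | .and φ ψ => .and (FormJ.subst p σ φ) (FormJ.subst p σ ψ)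
  | .box φ => .box (FormJ.subst p σ φ)
  | .ex q φ => if q = p then .ex q φ else .ex q (FormJ.subst p σ φ)
  | .uni φ => .uni (FormJ.subst p σ φ)

/-- Disjunction, defined from `¬` and `∧`. -/
def FormJ.or {n : ℕ} (φ ψ : FormJ n) : FormJ n := .neg (.and (.neg φ) (.neg ψ))

/-- Finite disjunction `⋁`. -/
def FormJ.bigOr {n : ℕ} : List (FormJ n) → FormJ n
  | [] => .and (.atom 0) (.neg (.atom 0))
  | [φ] => φ
  | φ :: ψ :: rest => φ.or (FormJ.bigOr (ψ :: rest))

/-- Simultaneous update of the valuation of the (distinct) letters `ps i` to `X i`. -/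
def Model.updateMany {W : Type} (M : Model W) {n : ℕ} (ps : Fin n → ℕ)
    (X : Fin n → Set W) : Model W :=
  ⟨M.rel, fun q => {w | (∃ i, ps i = q ∧ w ∈ X i) ∨ ((∀ i, ps i ≠ q) ∧ w ∈ M.val q)}⟩

/-- A concrete numerical encoding of `L∃U` formulas. -/
def Form.toNat : Form → ℕ
  | .atom p => Nat.pair 0 p
  | .neg φ => Nat.pair 1 φ.toNat
  | .and φ ψ => Nat.pair 2 (Nat.pair φ.toNat ψ.toNat)
  | .box φ => Nat.pair 3 φ.toNat
  | .ex p φ => Nat.pair 4 (Nat.pair p φ.toNat)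
  | .uni φ => Nat.pair 5 φ.toNat

/-- The language `L∃Uα`: `L∃U` with action modalities `⟨α⟩` for events `α` of an event model. -/
inductive FormA (n : ℕ) : Type where
  | atom : ℕ → FormA n
  | neg : FormA n → FormA n
  | and : FormA n → FormA n → FormA n
  | box : FormA n → FormA n
  | ex : ℕ → FormA n → FormA n
  | uni : FormA n → FormA n
  | act : Fin n → FormA n → FormA n

/-- Satisfaction for `L∃Uα`, relative to a fixed event model `A`. -/
def SatA {n : ℕ} (A : EventModel n) : (W : Type) → Model W → W → FormA n → Prop
  | _, M, w, .atom p => w ∈ M.val p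
  | W, M, w, .neg φ => ¬ SatA A W M w φ
  | W, M, w, .and φ ψ => SatA A W M w φ ∧ SatA A W M w ψ
  | W, M, w, .box φ => ∀ v, M.rel w v → SatA A W M v φ
  | W, M, w, .ex p φ => ∃ X : Set W, SatA A W (M.update p X) w φ
  | W, M, w, .uni φ => ∀ v, SatA A W M v φ
  | _, M, w, .act β φ => ∃ h : (w, β) ∈ prodDomain M A,
      SatA A (prodDomain M A) (prodModel M A) ⟨(w, β), h⟩ φ

/-- The set of points reachable from `ω` in at most `k` steps along `R`. -/
def reachWithin {W : Type} (M : Model W) (ω : W) : ℕ → Set W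
  | 0 => {ω}
  | k + 1 => reachWithin M ω k ∪ {v | ∃ u ∈ reachWithin M ω k, M.rel u v}

theorem mem_reachWithin_self {W : Type} (M : Model W) (ω : W) (k : ℕ) :
    ω ∈ reachWithin M ω k := by
  induction k with
  | zero => exact rfl
  | succ k ih => exact Or.inl ih

/-- `M^k_ω`: the submodel of `M` generated by going at most `k` steps along `R` from `ω`. -/
def Model.genSub {W : Type} (M : Model W) (ω : W) (k : ℕ) : Model (reachWithin M ω k) :=
  M.restrict (reachWithin M ω k)

/-- `φ ∈ L∃U` has degree `k`. -/
def HasDegreeForm (φ : Form) (k : ℕ) : Prop :=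
  ∀ (W : Type) (M : Model W) (ω : W),
    Sat M ω φ ↔ Sat (M.genSub ω k) ⟨ω, mem_reachWithin_self M ω k⟩ φ

/-- `φ ∈ L∃Uα` has degree `k`. -/
def HasDegreeA {n : ℕ} (A : EventModel n) (φ : FormA n) (k : ℕ) : Prop :=
  ∀ (W : Type) (M : Model W) (ω : W),
    SatA A W M ω φ ↔
      SatA A (reachWithin M ω k) (M.genSub ω k) ⟨ω, mem_reachWithin_self M ω k⟩ φ

/-- `deg(φ)` for `φ ∈ L∃U` (the least degree; `sInf ∅ = 0` by convention). -/
noncomputable def degForm (φ : Form) : ℕ := sInf {k | HasDegreeForm φ k}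

/-- `deg(φ)` for `φ ∈ L∃Uα`. -/
noncomputable def degA {n : ℕ} (A : EventModel n) (φ : FormA n) : ℕ :=
  sInf {k | HasDegreeA A φ k}

/-- `Z` is a bisimulation between `M` and `M'`. -/
def IsBisim {W W' : Type} (M : Model W) (M' : Model W') (Z : W → W' → Prop) : Prop :=
  ∀ s t, Z s t →
    (∀ p, s ∈ M.val p ↔ t ∈ M'.val p) ∧
    (∀ s₁, M.rel s s₁ → ∃ t₁, M'.rel t t₁ ∧ Z s₁ t₁) ∧
    (∀ t₁, M'.rel t t₁ → ∃ s₁, M.rel s s₁ ∧ Z s₁ t₁)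

/-- `φ ∈ L∃U` is bisimulation-invariant. -/
def BisimInvariant (φ : Form) : Prop :=
  ∀ (W W' : Type) (M : Model W) (M' : Model W') (Z : W → W' → Prop),
    IsBisim M M' Z → ∀ w w', Z w w' → (Sat M w φ ↔ Sat M' w' φ)

/-- The modal fixpoint language `L_μ` (with greatest-fixpoint binders `ν`). -/
inductive Formμ : Type where
  | atom : ℕ → Formμ
  | neg : Formμ → Formμ
  | and : Formμ → Formμ → Formμ
  | box : Formμ → Formμ
  | nu : ℕ → Formμ → Formμ

mutual
/-- All occurrences of `p` are under an even number of negations. -/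
def PosIn (p : ℕ) : Formμ → Prop
  | .atom _ => True
  | .neg φ => NegIn p φ
  | .and φ ψ => PosIn p φ ∧ PosIn p ψ
  | .box φ => PosIn p φ
  | .nu q φ => q = p ∨ PosIn p φ

/-- All occurrences of `p` are under an odd number of negations. -/
def NegIn (p : ℕ) : Formμ → Prop
  | .atom q => q ≠ p
  | .neg φ => PosIn p φ
  | .and φ ψ => NegIn p φ ∧ NegIn p ψ
  | .box φ => NegIn p φ
  | .nu q φ => q = p ∨ NegIn p φ
end

/-- Well-formedness for `L_μ`: in each `νp.φ`, `φ` is positive in `p`. -/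
def WFμ : Formμ → Prop
  | .atom _ => True
  | .neg φ => WFμ φ
  | .and φ ψ => WFμ φ ∧ WFμ ψ
  | .box φ => WFμ φ
  | .nu q φ => PosIn q φ ∧ WFμ φ

/-- Satisfaction for `L_μ`: `⟦νp.φ⟧ = ⋃ {X | ∀ ω ∈ X, M[p ↦ X], ω ⊨ φ}`. -/
def Satμ {W : Type} : Model W → W → Formμ → Prop
  | M, w, .atom p => w ∈ M.val p
  | M, w, .neg φ => ¬ Satμ M w φ
  | M, w, .and φ ψ => Satμ M w φ ∧ Satμ M w ψ
  | M, w, .box φ => ∀ v, M.rel w v → Satμ M v φ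
  | M, w, .nu q φ => w ∈ ⋃₀ {X : Set W | ∀ v ∈ X, Satμ (M.update q X) v φ}

/-- An event model with preconditions in `L_μ`. -/
structure EventModelμ (n : ℕ) where
  E : Fin n → Fin n → Prop
  pre : Fin n → Formμ

/-- The domain of the product update `M ⊗ A` for `L_μ` event models. -/
def prodDomainμ {W : Type} (M : Model W) {n : ℕ} (A : EventModelμ n) : Set (W × Fin n) :=
  {x | Satμ M x.1 (A.pre x.2)}

/-- The product update `M ⊗ A` for `L_μ` event models. -/
def prodModelμ {W : Type} (M : Model W) {n : ℕ} (A : EventModelμ n) :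
    Model (prodDomainμ M A) :=
  ⟨fun x y => M.rel x.1.1 y.1.1 ∧ A.E x.1.2 y.1.2, fun p => {x | x.1.1 ∈ M.val p}⟩

theorem Model.update_comm {W : Type} (M : Model W) {p q : ℕ} (h : p ≠ q) (X Y : Set W) :
    (M.update p X).update q Y = (M.update q Y).update p X := by
  simp only [Model.update, Model.mk.injEq, true_and]
  funext s
  by_cases hq : s = q
  · subst hq
    simp [h.symm]
  · simp [hq]

theorem Model.update_restrict {W : Type} (M : Model W) (S : Set W) (p : ℕ) (X : Set W) :
    (M.update p X).restrict S = (M.restrict S).update p (Subtype.val ⁻¹' X) := by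
  simp only [Model.update, Model.restrict, Model.mk.injEq, true_and]
  funext s
  split_ifs <;> rfl

/-- The truth of a formula does not depend on the value of a letter that does not occur in it. -/
theorem sat_update_of_not_occurs {W : Type} {r : ℕ} {φ : Form} (h : ¬ φ.Occurs r)
    (M : Model W) (X : Set W) (w : W) : Sat (M.update r X) w φ ↔ Sat M w φ := by
  induction φ generalizing M w with
  | atom q => simp only [Form.Occurs] at h; simp [Sat, Model.update, h]
  | neg φ ih => simp only [Sat, ih h]
  | and φ ψ ih₁ ih₂ =>
    simp only [Form.Occurs, not_or] at h
    simp only [Sat, ih₁ h.1, ih₂ h.2]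
  | box φ ih => simp only [Sat, ih h]; rfl
  | ex q φ ih =>
    simp only [Form.Occurs, not_or] at h
    simp only [Sat, M.update_comm (Ne.symm h.1), ih h.2]
  | uni φ ih => simp only [Sat, ih h]

theorem Form.Occurs.le_toNat {p : ℕ} {φ : Form} (h : φ.Occurs p) : p ≤ φ.toNat := by
  induction φ with
  | atom q => exact (Nat.right_le_pair 0 p).trans_eq (by rw [Form.toNat, show q = p from h])
  | neg φ ih => exact (ih h).trans (Nat.right_le_pair _ _)
  | and φ ψ ih₁ ih₂ =>
    refine le_trans ?_ (Nat.right_le_pair _ _)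
    exact h.elim (fun h => (ih₁ h).trans (Nat.left_le_pair _ _))
      (fun h => (ih₂ h).trans (Nat.right_le_pair _ _))
  | box φ ih => exact (ih h).trans (Nat.right_le_pair _ _)
  | ex q φ ih =>
    refine le_trans ?_ (Nat.right_le_pair _ _)
    exact h.elim (fun h => h ▸ Nat.left_le_pair _ _)
      (fun h => (ih h).trans (Nat.right_le_pair _ _))
  | uni φ ih => exact (ih h).trans (Nat.right_le_pair _ _)

/-- Relativisation of the modalities of a formula to the letter `r`. -/
def Form.relativise (r : ℕ) : Form → Form
  | .atom q => .atom q
  | .neg φ => .neg (φ.relativise r)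
  | .and φ ψ => .and (φ.relativise r) (ψ.relativise r)
  | .box φ => .box ((Form.atom r).imp (φ.relativise r))
  | .ex q φ => .ex q (φ.relativise r)
  | .uni φ => .uni ((Form.atom r).imp (φ.relativise r))

theorem sat_imp {W : Type} (M : Model W) (w : W) (φ ψ : Form) :
    Sat M w (φ.imp ψ) ↔ (Sat M w φ → Sat M w ψ) := by
  simp [Form.imp, Sat]

theorem sat_relativise {W : Type} {r : ℕ} {φ : Form} (h : ¬ φ.Occurs r) {S : Set W}
    (M : Model W) (hS : M.val r = S) (w : S) :
    Sat M w (φ.relativise r) ↔ Sat (M.restrict S) w φ := by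
  induction φ generalizing M w with
  | atom q => rfl
  | neg φ ih => simp only [Form.relativise, Sat, ih h M hS]
  | and φ ψ ih₁ ih₂ =>
    simp only [Form.Occurs, not_or] at h
    simp only [Form.relativise, Sat, ih₁ h.1 M hS, ih₂ h.2 M hS]
  | box φ ih =>
    simp only [Form.relativise, Sat, sat_imp, hS]
    exact ⟨fun H v hv => (ih h M hS v).1 (H v hv v.2),
      fun H v hv hvS => (ih h M hS ⟨v, hvS⟩).2 (H ⟨v, hvS⟩ hv)⟩
  | ex q φ ih =>
    simp only [Form.Occurs, not_or] at h
    have key (X : Set W) : Sat (M.update q X) w (φ.relativise r) ↔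
        Sat ((M.restrict S).update q (Subtype.val ⁻¹' X)) w φ := by
      rw [← Model.update_restrict]
      exact ih h.2 _ (by simpa [Model.update, Ne.symm h.1] using hS) w
    simp only [Form.relativise, Sat, key]
    refine ⟨fun ⟨X, hX⟩ => ⟨_, hX⟩, fun ⟨Y, hY⟩ => ⟨Subtype.val '' Y, ?_⟩⟩
    rwa [Set.preimage_image_eq Y Subtype.val_injective]
  | uni φ ih =>
    simp only [Form.relativise, Sat, sat_imp, hS]
    exact ⟨fun H v => (ih h M hS v).1 (H v v.2),
      fun H v hvS => (ih h M hS ⟨v, hvS⟩).2 (H ⟨v, hvS⟩)⟩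

/-- `φ` relativised to `A`, using the auxiliary letter `r` as a name for the extension of `A`. -/
def Form.relativiseTo (r : ℕ) (φ A : Form) : Form :=
  .ex r (.and (.uni (.and ((Form.atom r).imp A) (A.imp (.atom r))))
    (.and (.atom r) (φ.relativise r)))

theorem sat_relativiseTo {W : Type} {r : ℕ} {φ A : Form} (hφ : ¬ φ.Occurs r)
    (hA : ¬ A.Occurs r) (M : Model W) (w : W) :
    Sat M w (φ.relativiseTo r A) ↔ SatRel M w A φ := by
  have val_update (X : Set W) : (M.update r X).val r = X := by simp [Model.update]
  have restrict_iff (S : Set W) (w : S) :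
      Sat (M.update r S) w (φ.relativise r) ↔ Sat (M.restrict S) w φ := by
    rw [sat_relativise hφ _ (val_update S), Model.update_restrict, sat_update_of_not_occurs hφ]
  simp only [Form.relativiseTo, SatRel, Sat, sat_imp, val_update, sat_update_of_not_occurs hA]
  constructor
  · rintro ⟨X, hX, hw, h⟩
    obtain rfl : X = {v | Sat M v A} := Set.ext fun v => ⟨(hX v).1, (hX v).2⟩
    exact ⟨hw, (restrict_iff _ ⟨w, hw⟩).1 h⟩
  · rintro ⟨hw, h⟩
    exact ⟨_, fun v => ⟨id, id⟩, hw, (restrict_iff _ ⟨w, hw⟩).2 h⟩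

/-- The action of `Form.imp` on codes. -/
def impCode (a b : ℕ) : ℕ := Nat.pair 1 (Nat.pair 2 (Nat.pair a (Nat.pair 1 b)))

/-- The value of `Form.relativise r` on the code `L.length`, given the list `L` of its values on
smaller codes. -/
def relativiseStep (r : ℕ) (L : List ℕ) : ℕ :=
  if L.length.unpair.1 = 0 then L.length
  else if L.length.unpair.1 = 1 then Nat.pair 1 (L.getD L.length.unpair.2 0)
  else if L.length.unpair.1 = 2 then
    Nat.pair 2 (Nat.pair (L.getD L.length.unpair.2.unpair.1 0)
      (L.getD L.length.unpair.2.unpair.2 0))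
  else if L.length.unpair.1 = 3 then
    Nat.pair 3 (impCode (Nat.pair 0 r) (L.getD L.length.unpair.2 0))
  else if L.length.unpair.1 = 4 then
    Nat.pair 4 (Nat.pair L.length.unpair.2.unpair.1 (L.getD L.length.unpair.2.unpair.2 0))
  else Nat.pair 5 (impCode (Nat.pair 0 r) (L.getD L.length.unpair.2 0))

/-- The values of `Form.relativise r` on the codes smaller than `n`. -/
def relativiseTable (r n : ℕ) : List ℕ :=
  Nat.rec [] (fun _ L => L ++ [relativiseStep r L]) n

/-- The action of `Form.relativise r` on codes. -/
def relativiseCode (r n : ℕ) : ℕ := relativiseStep r (relativiseTable r n)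

theorem length_relativiseTable (r n : ℕ) : (relativiseTable r n).length = n := by
  induction n with
  | zero => rfl
  | succ n ih =>
    change (relativiseTable r n ++ [_]).length = n + 1
    simp [ih]

theorem getD_relativiseTable (r : ℕ) {m n : ℕ} (h : m < n) :
    (relativiseTable r n).getD m 0 = relativiseCode r m := by
  induction n with
  | zero => omega
  | succ n ih =>
    change (relativiseTable r n ++ [relativiseCode r n]).getD m 0 = _
    have hl := length_relativiseTable r n
    rcases Nat.lt_succ_iff_lt_or_eq.1 h with h | rfl
    · rw [List.getD_append _ _ _ _ (by omega), ih h]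
    · rw [List.getD_append_right _ _ _ _ (by omega)]
      simp [hl]

theorem lt_pair_of_pos {a : ℕ} (h : 0 < a) (b : ℕ) : b < Nat.pair a b := by
  unfold Nat.pair
  split_ifs <;> nlinarith

theorem relativiseCode_toNat (r : ℕ) (φ : Form) :
    relativiseCode r φ.toNat = (φ.relativise r).toNat := by
  induction φ with
  | atom q => simp [-List.getD_eq_getElem?_getD, relativiseCode, relativiseStep, length_relativiseTable, Form.toNat,
      Form.relativise]
  | neg φ ih =>
    have h := lt_pair_of_pos one_pos φ.toNat
    simp [-List.getD_eq_getElem?_getD, relativiseCode, relativiseStep, length_relativiseTable, Form.toNat,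
      Form.relativise, (getD_relativiseTable r h).trans ih]
  | and φ ψ ih₁ ih₂ =>
    have h := lt_pair_of_pos two_pos (Nat.pair φ.toNat ψ.toNat)
    simp [-List.getD_eq_getElem?_getD, relativiseCode, relativiseStep, length_relativiseTable, Form.toNat,
      Form.relativise, (getD_relativiseTable r ((Nat.left_le_pair _ _).trans_lt h)).trans ih₁,
      (getD_relativiseTable r ((Nat.right_le_pair _ _).trans_lt h)).trans ih₂]
  | box φ ih =>
    have h := lt_pair_of_pos three_pos φ.toNat
    simp [-List.getD_eq_getElem?_getD, relativiseCode, relativiseStep, length_relativiseTable, Form.toNat,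
      Form.relativise, Form.imp, impCode, (getD_relativiseTable r h).trans ih]
  | ex q φ ih =>
    have h := lt_pair_of_pos four_pos (Nat.pair q φ.toNat)
    simp [-List.getD_eq_getElem?_getD, relativiseCode, relativiseStep, length_relativiseTable, Form.toNat,
      Form.relativise, (getD_relativiseTable r ((Nat.right_le_pair _ _).trans_lt h)).trans ih]
  | uni φ ih =>
    have h := lt_pair_of_pos (by norm_num : 0 < 5) φ.toNat
    simp [-List.getD_eq_getElem?_getD, relativiseCode, relativiseStep, length_relativiseTable, Form.toNat,
      Form.relativise, Form.imp, impCode, (getD_relativiseTable r h).trans ih]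

theorem primrec_impCode : Primrec₂ impCode :=
  Primrec₂.natPair.comp (Primrec.const 1) <| Primrec₂.natPair.comp (Primrec.const 2) <|
    Primrec₂.natPair.comp Primrec.fst <| Primrec₂.natPair.comp (Primrec.const 1) Primrec.snd

theorem primrec_relativiseStep : Primrec₂ relativiseStep := by
  have len : Primrec fun x : ℕ × List ℕ => x.2.length := Primrec.list_length.comp Primrec.snd
  have tag : Primrec fun x : ℕ × List ℕ => x.2.length.unpair.1 :=
    Primrec.fst.comp (Primrec.unpair.comp len)
  have arg : Primrec fun x : ℕ × List ℕ => x.2.length.unpair.2 :=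
    Primrec.snd.comp (Primrec.unpair.comp len)
  have arg₁ : Primrec fun x : ℕ × List ℕ => x.2.length.unpair.2.unpair.1 :=
    Primrec.fst.comp (Primrec.unpair.comp arg)
  have arg₂ : Primrec fun x : ℕ × List ℕ => x.2.length.unpair.2.unpair.2 :=
    Primrec.snd.comp (Primrec.unpair.comp arg)
  have look {f : ℕ × List ℕ → ℕ} (hf : Primrec f) :
      Primrec fun x : ℕ × List ℕ => x.2.getD (f x) 0 :=
    (Primrec.list_getD 0).comp Primrec.snd hf
  have pair (c : ℕ) {f : ℕ × List ℕ → ℕ} (hf : Primrec f) :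
      Primrec fun x : ℕ × List ℕ => Nat.pair c (f x) :=
    Primrec₂.natPair.comp (Primrec.const c) hf
  have tagEq (c : ℕ) : PrimrecPred fun x : ℕ × List ℕ => x.2.length.unpair.1 = c :=
    Primrec.eq.comp tag (Primrec.const c)
  have guard := primrec_impCode.comp (pair 0 Primrec.fst) (look arg)
  exact Primrec.ite (tagEq 0) len <|
    Primrec.ite (tagEq 1) (pair 1 (look arg)) <|
    Primrec.ite (tagEq 2) (pair 2 (Primrec₂.natPair.comp (look arg₁) (look arg₂))) <|
    Primrec.ite (tagEq 3) (pair 3 guard) <|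
    Primrec.ite (tagEq 4) (pair 4 (Primrec₂.natPair.comp arg₁ (look arg₂))) (pair 5 guard)

theorem primrec_relativiseCode : Primrec₂ relativiseCode := by
  have table : Primrec₂ relativiseTable :=
    Primrec.nat_rec (Primrec.const []) <|
      (Primrec.list_append.comp (Primrec.snd.comp Primrec.snd) <|
        Primrec.list_cons.comp
          (primrec_relativiseStep.comp Primrec.fst (Primrec.snd.comp Primrec.snd))
          (Primrec.const [])).to₂
  exact primrec_relativiseStep.comp Primrec.fst table

/-- The action of `Form.relativiseTo r` on codes. -/
def relativiseToCode (r a b : ℕ) : ℕ :=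
  Nat.pair 4 (Nat.pair r (Nat.pair 2 (Nat.pair
    (Nat.pair 5 (Nat.pair 2 (Nat.pair (impCode (Nat.pair 0 r) b) (impCode b (Nat.pair 0 r)))))
    (Nat.pair 2 (Nat.pair (Nat.pair 0 r) (relativiseCode r a))))))

theorem relativiseToCode_toNat (r : ℕ) (φ A : Form) :
    relativiseToCode r φ.toNat A.toNat = (φ.relativiseTo r A).toNat := by
  simp [relativiseToCode, relativiseCode_toNat, Form.relativiseTo, Form.toNat, Form.imp, impCode]

theorem primrec_relativiseToCode {r a b : ℕ → ℕ} (hr : Primrec r) (ha : Primrec a)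
    (hb : Primrec b) : Primrec fun n => relativiseToCode (r n) (a n) (b n) := by
  have pair {f g : ℕ → ℕ} (hf : Primrec f) (hg : Primrec g) :
      Primrec fun n => Nat.pair (f n) (g n) := Primrec₂.natPair.comp hf hg
  have const (c : ℕ) : Primrec fun _ : ℕ => c := Primrec.const c
  have letter := pair (const 0) hr
  exact pair (const 4) <| pair hr <| pair (const 2) <| pair
    (pair (const 5) <| pair (const 2) <|
      pair (primrec_impCode.comp letter hb) (primrec_impCode.comp hb letter))
    (pair (const 2) <| pair letter (primrec_relativiseCode.comp hr ha))

/-- `L∃U` is computably closed for relativisation: there is a computable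
function producing, from (codes of) `φ` and `A`, (the code of) a formula `ψ ∈ L∃U` whose
extension in any model `M` equals the extension of `φ` in the relativised model
`M | ⟦A⟧^M`. -/
theorem stmt1 :
    ∃ F : ℕ → ℕ, Computable F ∧
      ∀ φ A : Form, ∃ ψ : Form,
        F (Nat.pair φ.toNat A.toNat) = ψ.toNat ∧
        ∀ (W : Type) (M : Model W),
          {w | Sat M w ψ} =
            Subtype.val '' {a : {v | Sat M v A} | Sat (M.restrict {v | Sat M v A}) a φ} := by
  refine ⟨fun n => relativiseToCode (n + 1) n.unpair.1 n.unpair.2,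
    (primrec_relativiseToCode Primrec.succ (Primrec.fst.comp Primrec.unpair)
      (Primrec.snd.comp Primrec.unpair)).to_comp, fun φ A =>
    ⟨φ.relativiseTo (Nat.pair φ.toNat A.toNat + 1) A, ?_, fun W M => ?_⟩⟩
  · simp [relativiseToCode_toNat]
  · have hφ : ¬ φ.Occurs (Nat.pair φ.toNat A.toNat + 1) := fun h =>
      absurd (h.le_toNat.trans (Nat.left_le_pair _ A.toNat)) (Nat.not_succ_le_self _)
    have hA : ¬ A.Occurs (Nat.pair φ.toNat A.toNat + 1) := fun h =>
      absurd (h.le_toNat.trans (Nat.right_le_pair φ.toNat _)) (Nat.not_succ_le_self _)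
    ext w
    simp only [Set.mem_ofPred_eq, sat_relativiseTo hφ hA, SatRel, Set.mem_image, Subtype.exists,
      exists_and_right, exists_eq_right]
    rfl
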